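/- Let N, M, K, H be positive integers, ε ≥ 0, η > 0. Let U ∈ ℝ^{N×M} be a nonzero matrix with nonnegative entries, let V^1, …, V^K ∈ ℝ^{N×M}, and set L = 2η max_{k∈[K]} ‖V^k‖₁. Let a_0, a_1, a_2, … be nonnegative weights with a_0 > 0, and for leader strategies x^1,…,x^H define b_t, z^t, θ_t, Θ_H as in the context. Let g^1, …, g^H ∈ {e_1,…,e_K} with G^t = Σ_{τ=1}^t g^τ, G^0 = 0. Set ν = 1/(‖U‖₁ (1+L) √(50 N (Θ_H + H))), let σ = (σ_1,…,σ_N) have i.i.d. coordinates exponentially distributed with rate ν, and suppose x^1, …, x^H are measurable Δ_N-valued functions of σ such that for every σ ∈ ℝ^N_{≥0} and every t ∈ {1,…,H}, ⟨𝒴_QR(x^t(σ))ᵀ Uᵀ x^t(σ), G^{t−1}⟩ + ⟨σ, x^t(σ)⟩ ≥ max_{x∈Δ_N} [⟨𝒴_QR(x)ᵀ Uᵀ x, G^{t−1}⟩ + ⟨σ, x⟩] − ε. Then E[ max_{x∈Δ_N} ⟨𝒴_QR(x)ᵀ Uᵀ x, G^H⟩ − Σ_{t=1}^H ⟨𝒴_QR(z^t)ᵀ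 Uᵀ x^t, g^t⟩ ] ≤ 10 N ‖U‖₁ (1+L) √(2 N (H + Θ_H)) + ε(13H + 1), where the expectation is over σ. -/

import Mathlib

open MeasureTheory

/-- The law of a random vector in `ℝ^N` whose coordinates are i.i.d. exponential with rate `ν`. -/
noncomputable def expPi (N : ℕ) (ν : ℝ) : Measure (Fin N → ℝ) :=
  Measure.pi fun _ => ProbabilityTheory.expMeasure ν

/-- The quantal response map: `(qr η V x) i = exp(η⟨V_i, x⟩) / ∑_j exp(η⟨V_j, x⟩)`,
where `V_i` is the `i`-th column of `V ∈ ℝ^{N×M}`. -/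
noncomputable def qr {N M : ℕ} (η : ℝ) (V : Matrix (Fin N) (Fin M) ℝ)
    (x : Fin N → ℝ) (i : Fin M) : ℝ :=
  Real.exp (η * ∑ n, V n i * x n) / ∑ j, Real.exp (η * ∑ n, V n j * x n)

/-- The induced operator `1`-norm of a matrix `A`: `sup_{‖u‖₁ = 1} ‖A u‖₁`. -/
noncomputable def l1OpNorm {N M : ℕ} (A : Matrix (Fin N) (Fin M) ℝ) : ℝ :=
  sSup {r : ℝ | ∃ u : Fin M → ℝ, (∑ j, |u j|) = 1 ∧ r = ∑ i, |A.mulVec u i|}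

/-- The leader's payoff against quantal-responding followers:
`⟨𝒴_QR(z)ᵀ Uᵀ x, g⟩ = ∑_k g_k · xᵀ U y_{V^k}(z)`. -/
noncomputable def qrPayoff {N M K : ℕ} (η : ℝ) (U : Matrix (Fin N) (Fin M) ℝ)
    (V : Fin K → Matrix (Fin N) (Fin M) ℝ) (z x : Fin N → ℝ) (g : Fin K → ℝ) : ℝ :=
  ∑ k, g k * ∑ i, x i * ∑ j, U i j * qr η (V k) z j

/-- Paper's `b_t = ∑_{τ=1}^t a_{t−τ} = ∑_{s<t} a_s` (for `t ≥ 1`). -/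
noncomputable def memB (a : ℕ → ℝ) (t : ℕ) : ℝ := ∑ s ∈ Finset.range t, a s

/-- Paper's `θ_t = (1/b_t) ∑_{τ=1}^t a_{t−τ}(t−τ) = (1/b_t) ∑_{s<t} a_s · s` (for `t ≥ 1`). -/
noncomputable def memTheta (a : ℕ → ℝ) (t : ℕ) : ℝ :=
  (memB a t)⁻¹ * ∑ s ∈ Finset.range t, a s * s

/-- Paper's `Θ_H = ∑_{t=1}^H θ_t`. -/
noncomputable def memThetaSum (a : ℕ → ℝ) (H : ℕ) : ℝ :=
  ∑ t ∈ Finset.range H, memTheta a (t + 1)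

/-- The leader's reputation `z^t`: the weighted time-average of her strategies.  With
0-indexed rounds, at round `t` (paper's round `t+1`) it is
`z = (1/b_{t+1}) ∑_{τ≤t} a_{t−τ} x^τ`. -/
noncomputable def reput {N : ℕ} (a : ℕ → ℝ) (x : ℕ → Fin N → ℝ) (t : ℕ) : Fin N → ℝ :=
  (memB a (t + 1))⁻¹ • ∑ τ ∈ Finset.range (t + 1), a (t - τ) • x τ


open ProbabilityTheory in
lemma expMeasure_lintegral {r : ℝ} {f : ℝ → ENNReal} (hf : Measurable f) :
    ∫⁻ t, f t ∂(expMeasure r) = ∫⁻ t, exponentialPDF r t * f t := by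
  have h : expMeasure r = volume.withDensity (exponentialPDF r) := rfl
  rw [h, lintegral_withDensity_eq_lintegral_mul _ _ hf]
  · rfl
  · exact (measurable_exponentialPDFReal r).ennreal_ofReal

open ProbabilityTheory in
lemma expMeasure_shift {r s : ℝ} (hs : 0 ≤ s) {f : ℝ → ENNReal} (hf : Measurable f) :
    ENNReal.ofReal (Real.exp (-(r * s))) * ∫⁻ t, f (t + s) ∂(expMeasure r)
      ≤ ∫⁻ t, f t ∂(expMeasure r) := by
  have hp : Measurable (exponentialPDF r) := (measurable_exponentialPDFReal r).ennreal_ofReal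
  rw [expMeasure_lintegral hf, expMeasure_lintegral (f := fun t => f (t + s)) (by fun_prop),
    ← lintegral_const_mul _ (by fun_prop),
    ← lintegral_add_right_eq_self (fun t => exponentialPDF r t * f t) s]
  refine lintegral_mono fun t => ?_
  simp only
  rw [← mul_assoc]
  gcongr
  by_cases ht : 0 ≤ t
  · rw [exponentialPDF_of_nonneg ht, exponentialPDF_of_nonneg (by linarith),
      ← ENNReal.ofReal_mul (Real.exp_pos _).le]
    apply ENNReal.ofReal_le_ofReal
    apply le_of_eq
    rw [mul_left_comm, ← Real.exp_add]
    congr 2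
    ring
  · rw [exponentialPDF_of_neg (not_le.mp ht)]
    simp

open ProbabilityTheory in
lemma expMeasure_nonneg {r : ℝ} : ∀ᵐ t ∂(expMeasure r), 0 ≤ t := by
  rw [ae_iff]
  have h : expMeasure r = volume.withDensity (exponentialPDF r) := rfl
  have h2 : {t : ℝ | ¬ 0 ≤ t} = Set.Iio 0 := by ext t; simp
  rw [h2, h, withDensity_apply _ measurableSet_Iio]
  exact lintegral_exponentialPDF_of_nonpos le_rfl

open ProbabilityTheory in
lemma expMeasure_mean_lintegral {r : ℝ} (hr : 0 < r) :
    ∫⁻ t, ENNReal.ofReal t ∂(expMeasure r) = ENNReal.ofReal (1 / r) := by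
  rw [expMeasure_lintegral (by fun_prop)]
  have h : ∀ t, exponentialPDF r t * ENNReal.ofReal t =
      ENNReal.ofReal (1 / r) * gammaPDF 2 r t := by
    intro t
    by_cases ht : 0 ≤ t
    · rw [exponentialPDF_of_nonneg ht, gammaPDF_of_nonneg ht, ← ENNReal.ofReal_mul (by positivity),
        ← ENNReal.ofReal_mul (by positivity)]
      congr 1
      have h2 : Real.Gamma 2 = 1 := Real.Gamma_two
      have h3 : t ^ ((2:ℝ) - 1) = t := by norm_num
      rw [h2, h3, Real.rpow_two]
      field_simp
    · rw [exponentialPDF_of_neg (not_le.mp ht), gammaPDF_of_neg (not_le.mp ht)]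
      simp
  simp_rw [h]
  rw [lintegral_const_mul _ (show Measurable (gammaPDF 2 r) from
      (measurable_gammaPDFReal 2 r).ennreal_ofReal),
    lintegral_gammaPDF_eq_one (by norm_num) hr, mul_one]

open ProbabilityTheory in
lemma expMeasure_integrable {r : ℝ} (hr : 0 < r) : Integrable (fun t : ℝ => t) (expMeasure r) := by
  refine ⟨by fun_prop, ?_⟩
  rw [hasFiniteIntegral_iff_ofReal expMeasure_nonneg, expMeasure_mean_lintegral hr]
  exact ENNReal.ofReal_lt_top

open ProbabilityTheory in
lemma expMeasure_mean {r : ℝ} (hr : 0 < r) : ∫ t, t ∂(expMeasure r) = 1 / r := by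
  rw [integral_eq_lintegral_of_nonneg_ae expMeasure_nonneg (by fun_prop),
    expMeasure_mean_lintegral hr, ENNReal.toReal_ofReal (by positivity)]

lemma expPi_prob {N : ℕ} {ν : ℝ} (hν : 0 < ν) : IsProbabilityMeasure (expPi N ν) := by
  have := ProbabilityTheory.isProbabilityMeasure_expMeasure hν
  unfold expPi
  infer_instance

lemma expPi_nonneg {N : ℕ} {ν : ℝ} (hν : 0 < ν) : ∀ᵐ σ ∂(expPi N ν), ∀ i, 0 ≤ σ i := by
  have := ProbabilityTheory.isProbabilityMeasure_expMeasure hν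
  rw [ae_all_iff]
  intro i
  exact (measurePreserving_eval (fun _ : Fin N => ProbabilityTheory.expMeasure ν)
    i).quasiMeasurePreserving.ae expMeasure_nonneg

lemma expPi_sum_integrable {N : ℕ} {ν : ℝ} (hν : 0 < ν) :
    Integrable (fun σ : Fin N → ℝ => ∑ i, σ i) (expPi N ν) := by
  have := ProbabilityTheory.isProbabilityMeasure_expMeasure hν
  refine integrable_finsetSum _ fun i _ => ?_
  exact integrable_comp_eval (μ := fun _ : Fin N => ProbabilityTheory.expMeasure ν)
    (f := fun t => t) (expMeasure_integrable hν)

lemma expPi_sum {N : ℕ} {ν : ℝ} (hν : 0 < ν) :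
    ∫ σ : Fin N → ℝ, ∑ i, σ i ∂(expPi N ν) = N / ν := by
  have := ProbabilityTheory.isProbabilityMeasure_expMeasure hν
  rw [integral_finsetSum]
  · have : ∀ i : Fin N, ∫ σ : Fin N → ℝ, σ i ∂(expPi N ν) = 1 / ν := fun i => by
      rw [← expMeasure_mean hν]
      exact integral_comp_eval (μ := fun _ : Fin N => ProbabilityTheory.expMeasure ν)
        (f := fun t => t) (by fun_prop)
    simp [this, div_eq_mul_inv]
  · intro i _
    exact integrable_comp_eval (μ := fun _ : Fin N => ProbabilityTheory.expMeasure ν)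
      (f := fun t => t) (expMeasure_integrable hν)

lemma expPi_shift_lintegral {N : ℕ} {ν s : ℝ} (hν : 0 < ν) (hs : 0 ≤ s) (i : Fin N)
    {f : (Fin N → ℝ) → ENNReal} (hf : Measurable f) :
    ENNReal.ofReal (Real.exp (-(ν * s))) * ∫⁻ σ, f (σ + (Pi.single i s : Fin N → ℝ)) ∂(expPi N ν)
      ≤ ∫⁻ σ, f σ ∂(expPi N ν) := by
  have := ProbabilityTheory.isProbabilityMeasure_expMeasure hν
  obtain _ | n := N
  · exact i.elim0
  have mp := (measurePreserving_piFinSuccAbove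
    (fun _ : Fin (n+1) => ProbabilityTheory.expMeasure ν) i).symm
  have key : ∀ f : (Fin (n+1) → ℝ) → ENNReal, Measurable f → ∫⁻ σ, f σ ∂(expPi (n+1) ν) =
      ∫⁻ q : Fin n → ℝ, ∫⁻ t, f (i.insertNth t q) ∂(ProbabilityTheory.expMeasure ν)
        ∂(Measure.pi fun _ => ProbabilityTheory.expMeasure ν) := by
    intro f hf
    have h1 := mp.lintegral_comp hf
    unfold expPi
    rw [← h1, lintegral_prod_symm]
    · rfl
    · exact (hf.comp (MeasurableEquiv.measurable _)).aemeasurable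
  have hmeas : Measurable fun p : ℝ × (Fin n → ℝ) => (i.insertNth p.1 p.2 : Fin (n+1) → ℝ) :=
    (MeasurableEquiv.piFinSuccAbove (fun _ : Fin (n+1) => ℝ) i).symm.measurable
  have hfi : Measurable fun p : ℝ × (Fin n → ℝ) => f (i.insertNth p.1 p.2 + (Pi.single i s : Fin (n+1) → ℝ)) := by
    fun_prop
  rw [key f hf, key (fun σ => f (σ + (Pi.single i s : Fin (n+1) → ℝ))) (by fun_prop), ← lintegral_const_mul]
  · refine lintegral_mono fun q => ?_
    have h2 : ∀ t, (i.insertNth t q : Fin (n+1) → ℝ) + (Pi.single i s : Fin (n+1) → ℝ) = i.insertNth (t + s) q := by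
      intro t
      ext j
      refine Fin.succAboveCases i ?_ (fun j => ?_) j
      · simp
      · simp
    simp only [h2]
    exact expMeasure_shift hs (f := fun t => f (i.insertNth t q))
      (hf.comp (hmeas.comp (measurable_id.prodMk measurable_const)))
  · exact hfi.lintegral_prod_left'

/-- Shift inequality for real integrals. -/
lemma expPi_shift {N : ℕ} {ν s : ℝ} (hν : 0 < ν) (hs : 0 ≤ s) (i : Fin N)
    {f : (Fin N → ℝ) → ℝ} (hf : Measurable f) (hint : Integrable f (expPi N ν))
    (h0 : ∀ σ, (∀ i, 0 ≤ σ i) → 0 ≤ f σ) :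
    Real.exp (-(ν * s)) * ∫ σ, f (σ + (Pi.single i s : Fin N → ℝ)) ∂(expPi N ν)
      ≤ ∫ σ, f σ ∂(expPi N ν) := by
  have e1 : 0 ≤ᵐ[expPi N ν] f := by
    filter_upwards [expPi_nonneg hν] with σ hσ using h0 σ hσ
  have e2 : 0 ≤ᵐ[expPi N ν] fun σ => f (σ + (Pi.single i s : Fin N → ℝ)) := by
    filter_upwards [expPi_nonneg hν] with σ hσ
    refine h0 _ fun j => add_nonneg (hσ j) ?_
    by_cases h : j = i
    · subst h; simpa using hs
    · simp [h]
  have hm2 : Measurable fun σ => f (σ + (Pi.single i s : Fin N → ℝ)) := by fun_prop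
  rw [integral_eq_lintegral_of_nonneg_ae e1 hf.aestronglyMeasurable,
    integral_eq_lintegral_of_nonneg_ae e2 hm2.aestronglyMeasurable]
  have h3 := expPi_shift_lintegral hν hs i (f := fun σ => ENNReal.ofReal (f σ)) (by fun_prop)
  have h4 : ∫⁻ σ, ENNReal.ofReal (f σ) ∂(expPi N ν) ≠ ⊤ :=
    ((hasFiniteIntegral_iff_ofReal e1).1 hint.2).ne
  have h5 := ENNReal.toReal_mono h4 h3
  rwa [ENNReal.toReal_mul, ENNReal.toReal_ofReal (Real.exp_pos _).le] at h5

/-- One-sided deterministic stability: shifting the perturbation in coordinate `i` by `s`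
pushes the `i`-th coordinate of the approximate maximizer above both maximizers. -/
lemma shift_coord {N : ℕ} {ε s lam : ℝ} (hε : 0 ≤ ε) (hs : 0 < s) (hlam : 0 ≤ lam)
    (F h : (Fin N → ℝ) → ℝ) (σ : Fin N → ℝ) (i : Fin N) (x x' y : Fin N → ℝ)
    (hx' : x' ∈ stdSimplex ℝ (Fin N)) (hx : x ∈ stdSimplex ℝ (Fin N))
    (hy : y ∈ stdSimplex ℝ (Fin N))
    (hLip : ∀ u ∈ stdSimplex ℝ (Fin N), ∀ v ∈ stdSimplex ℝ (Fin N),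
      h u - h v ≤ lam * ∑ j, |u j - v j|)
    (ox : ∀ u ∈ stdSimplex ℝ (Fin N), F u + ∑ j, σ j * u j - ε ≤ F x + ∑ j, σ j * x j)
    (ox' : ∀ u ∈ stdSimplex ℝ (Fin N),
      F u + h u + ∑ j, σ j * u j - ε ≤ F x' + h x' + ∑ j, σ j * x' j)
    (oy : ∀ u ∈ stdSimplex ℝ (Fin N), F u + ∑ j, (σ + (Pi.single i s : Fin N → ℝ)) j * u j - ε
      ≤ F y + ∑ j, (σ + (Pi.single i s : Fin N → ℝ)) j * y j) :
    max (x i) (x' i) - (lam * (∑ j, |x j - x' j|) + 3 * ε) / s ≤ y i := by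
  have hsum : ∀ u : Fin N → ℝ, ∑ j, (σ + (Pi.single i s : Fin N → ℝ)) j * u j
      = ∑ j, σ j * u j + s * u i := by
    intro u
    simp [add_mul, Finset.sum_add_distrib, Pi.single_apply]
  simp only [hsum] at oy
  have h1 := oy x hx
  have h2 := oy x' hx'
  have h3 := ox y hy
  have h4 := ox' x hx
  have h5 := hLip x' hx' x hx
  have h6 : ∑ j, |x' j - x j| = ∑ j, |x j - x' j| :=
    Finset.sum_congr rfl fun j _ => abs_sub_comm _ _
  rw [h6] at h5
  have hD : 0 ≤ lam * ∑ j, |x j - x' j| :=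
    mul_nonneg hlam (Finset.sum_nonneg fun j _ => abs_nonneg _)
  rw [sub_le_iff_le_add, max_le_iff]
  constructor
  · rw [← sub_le_iff_le_add', le_div_iff₀ hs]
    nlinarith
  · rw [← sub_le_iff_le_add', le_div_iff₀ hs]
    nlinarith

lemma simplex_le_one {N : ℕ} {x : Fin N → ℝ} (hx : x ∈ stdSimplex ℝ (Fin N)) (i : Fin N) :
    x i ≤ 1 := by
  rw [← hx.2]
  exact Finset.single_le_sum (f := x) (fun j _ => hx.1 j) (Finset.mem_univ i)

lemma integrable_of_bdd {N : ℕ} {ν : ℝ} (hν : 0 < ν) {f : (Fin N → ℝ) → ℝ} (hf : Measurable f)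
    (C : ℝ) (hC : ∀ σ, (∀ i, 0 ≤ σ i) → |f σ| ≤ C) : Integrable f (expPi N ν) := by
  have := expPi_prob (N := N) hν
  refine Integrable.of_bound hf.aestronglyMeasurable C ?_
  filter_upwards [expPi_nonneg hν] with σ hσ using hC σ hσ

/-- Stability of approximate FTPL. -/
lemma ftpl_stability {N : ℕ} (hN : 0 < N) {ν ε lam : ℝ} (hν : 0 < ν) (hε : 0 ≤ ε) (hlam : 0 < lam)
    (F h : (Fin N → ℝ) → ℝ) (x x' : (Fin N → ℝ) → (Fin N → ℝ))
    (hxm : Measurable x) (hxm' : Measurable x')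
    (hx : ∀ σ : Fin N → ℝ, (∀ i, 0 ≤ σ i) → x σ ∈ stdSimplex ℝ (Fin N))
    (hx' : ∀ σ : Fin N → ℝ, (∀ i, 0 ≤ σ i) → x' σ ∈ stdSimplex ℝ (Fin N))
    (hLip : ∀ u ∈ stdSimplex ℝ (Fin N), ∀ v ∈ stdSimplex ℝ (Fin N),
      h u - h v ≤ lam * ∑ j, |u j - v j|)
    (ox : ∀ σ : Fin N → ℝ, (∀ i, 0 ≤ σ i) → ∀ u ∈ stdSimplex ℝ (Fin N),
      F u + ∑ j, σ j * u j - ε ≤ F (x σ) + ∑ j, σ j * x σ j)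
    (ox' : ∀ σ : Fin N → ℝ, (∀ i, 0 ≤ σ i) → ∀ u ∈ stdSimplex ℝ (Fin N),
      F u + h u + ∑ j, σ j * u j - ε ≤ F (x' σ) + h (x' σ) + ∑ j, σ j * x' σ j) :
    ∫ σ, ∑ j, |x σ j - x' σ j| ∂(expPi N ν) ≤ 8 * N * ν * lam + 3 * ε / lam := by
  have hprob := expPi_prob (N := N) hν
  have hNr : (0:ℝ) < N := by exact_mod_cast hN
  set s : ℝ := 2 * N * lam with hsdef
  have hs : 0 < s := by positivity
  have mx : ∀ i, Measurable fun σ => x σ i := fun i => (measurable_pi_apply i).comp hxm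
  have mx' : ∀ i, Measurable fun σ => x' σ i := fun i => (measurable_pi_apply i).comp hxm'
  have imax : ∀ i, Integrable (fun σ => max (x σ i) (x' σ i)) (expPi N ν) := fun i =>
    integrable_of_bdd hν ((mx i).max (mx' i)) 1 fun σ hσ => by
      rw [abs_of_nonneg (le_max_of_le_left ((hx σ hσ).1 i))]
      exact max_le (simplex_le_one (hx σ hσ) i) (simplex_le_one (hx' σ hσ) i)
  have imin : ∀ i, Integrable (fun σ => min (x σ i) (x' σ i)) (expPi N ν) := fun i =>
    integrable_of_bdd hν ((mx i).min (mx' i)) 1 fun σ hσ => by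
      rw [abs_of_nonneg (le_min ((hx σ hσ).1 i) ((hx' σ hσ).1 i))]
      exact min_le_of_left_le (simplex_le_one (hx σ hσ) i)
  have hshift0 : ∀ (i : Fin N) (σ : Fin N → ℝ), (∀ i, 0 ≤ σ i) →
      ∀ j, 0 ≤ (σ + (Pi.single i s : Fin N → ℝ)) j := by
    intro i σ hσ j
    refine add_nonneg (hσ j) ?_
    by_cases hj : j = i
    · subst hj; simpa using hs.le
    · simp [hj]
  have iminS : ∀ i : Fin N, Integrable (fun σ => min (x (σ + (Pi.single i s : Fin N → ℝ)) i)
      (x' (σ + (Pi.single i s : Fin N → ℝ)) i)) (expPi N ν) := fun i =>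
    integrable_of_bdd hν (((mx i).comp (measurable_add_const _)).min
      ((mx' i).comp (measurable_add_const _))) 1 fun σ hσ => by
      have a1 := hx _ (hshift0 i σ hσ)
      have a2 := hx' _ (hshift0 i σ hσ)
      rw [abs_of_nonneg (le_min (a1.1 i) (a2.1 i))]
      exact min_le_of_left_le (simplex_le_one a1 i)
  have iabs : ∀ i, Integrable (fun σ => |x σ i - x' σ i|) (expPi N ν) := fun i =>
    integrable_of_bdd hν (_root_.continuous_abs.measurable.comp ((mx i).sub (mx' i))) 1
      fun σ hσ => by
      rw [abs_abs, abs_le]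
      have a1 := simplex_le_one (hx σ hσ) i
      have a2 := simplex_le_one (hx' σ hσ) i
      have a3 := (hx σ hσ).1 i
      have a4 := (hx' σ hσ).1 i
      constructor <;> linarith
  set D : ℝ := ∫ σ, ∑ j, |x σ j - x' σ j| ∂(expPi N ν) with hD
  have iD : Integrable (fun σ => ∑ j, |x σ j - x' σ j|) (expPi N ν) :=
    integrable_finsetSum _ fun j _ => iabs j
  have hDsum : D = ∑ j, ∫ σ, |x σ j - x' σ j| ∂(expPi N ν) :=
    integral_finsetSum _ fun j _ => iabs j
  have hD0 : 0 ≤ D := integral_nonneg fun σ => Finset.sum_nonneg fun j _ => abs_nonneg _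
  -- per-coordinate bound
  have hcoord : ∀ i, ∫ σ, |x σ i - x' σ i| ∂(expPi N ν) ≤
      ν * s * ∫ σ, max (x σ i) (x' σ i) ∂(expPi N ν) + (lam * D + 3 * ε) / s := by
    intro i
    have e1 : ∫ σ, |x σ i - x' σ i| ∂(expPi N ν) = ∫ σ, max (x σ i) (x' σ i) ∂(expPi N ν)
        - ∫ σ, min (x σ i) (x' σ i) ∂(expPi N ν) := by
      rw [← integral_sub (imax i) (imin i)]
      refine integral_congr_ae (Filter.Eventually.of_forall fun σ => ?_)
      simp only
      rw [max_sub_min_eq_abs']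
    have e2 := expPi_shift hν hs.le i ((mx i).min (mx' i)) (imin i)
      (fun σ hσ => le_min ((hx σ hσ).1 i) ((hx' σ hσ).1 i))
    have e3 : ∫ σ, (max (x σ i) (x' σ i) - (lam * (∑ j, |x σ j - x' σ j|) + 3 * ε) / s)
        ∂(expPi N ν) ≤ ∫ σ, min (x (σ + (Pi.single i s : Fin N → ℝ)) i)
      (x' (σ + (Pi.single i s : Fin N → ℝ)) i) ∂(expPi N ν) := by
      refine integral_mono_ae ?_ (iminS i) ?_
      · exact (imax i).sub (((iD.const_mul lam).add (integrable_const _)).div_const _)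
      · filter_upwards [expPi_nonneg hν] with σ hσ
        have hσ' := hshift0 i σ hσ
        refine le_min ?_ ?_
        · exact shift_coord hε hs hlam.le F h σ i _ _ _ (hx' σ hσ) (hx σ hσ) (hx _ hσ') hLip
            (ox σ hσ) (ox' σ hσ) (ox _ hσ')
        · have := shift_coord hε hs hlam.le (fun u => F u + h u) (fun u => - h u) σ i _ _ _
            (hx σ hσ) (hx' σ hσ) (hx' _ hσ')
            (fun u hu v hv => by
              have h1 := hLip v hv u hu
              have h6 : ∑ j, |u j - v j| = ∑ j, |v j - u j| :=
                Finset.sum_congr rfl fun j _ => abs_sub_comm _ _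
              rw [h6]; linarith)
            (ox' σ hσ) (fun u hu => by have := ox σ hσ u hu; linarith) (ox' _ hσ')
          have h6 : ∑ j, |x' σ j - x σ j| = ∑ j, |x σ j - x' σ j| :=
                Finset.sum_congr rfl fun j _ => abs_sub_comm _ _
          rw [h6, max_comm] at this
          exact this
    have e4 : ∫ σ, (max (x σ i) (x' σ i) - (lam * (∑ j, |x σ j - x' σ j|) + 3 * ε) / s)
        ∂(expPi N ν) = ∫ σ, max (x σ i) (x' σ i) ∂(expPi N ν) - (lam * D + 3 * ε) / s := by
      have i1 : Integrable (fun σ => lam * (∑ j, |x σ j - x' σ j|)) (expPi N ν) := iD.const_mul lam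
      have i2 : Integrable (fun σ => (lam * (∑ j, |x σ j - x' σ j|) + 3 * ε) / s) (expPi N ν) :=
        (i1.add (integrable_const _)).div_const _
      rw [integral_sub (imax i) i2, integral_div,
        integral_add i1 (integrable_const _), integral_const_mul]
      simp [hD]
    rw [e4] at e3
    have e5 : 1 - ν * s ≤ Real.exp (-(ν * s)) := by
      have := Real.add_one_le_exp (-(ν * s)); linarith
    have e6 : Real.exp (-(ν * s)) ≤ 1 := Real.exp_le_one_iff.2 (by nlinarith [mul_pos hν hs])
    have e7 : 0 ≤ ∫ σ, max (x σ i) (x' σ i) ∂(expPi N ν) := by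
      refine integral_nonneg_of_ae ?_
      filter_upwards [expPi_nonneg hν] with σ hσ using le_max_of_le_left ((hx σ hσ).1 i)
    have e8 : 0 ≤ (lam * D + 3 * ε) / s := by positivity
    have e9 := mul_le_mul_of_nonneg_left e3 (Real.exp_pos (-(ν * s))).le
    rw [e1]
    nlinarith [mul_le_mul_of_nonneg_right e5 e7, mul_le_mul_of_nonneg_right e6 e8]
  have hmaxsum : ∑ i, ∫ σ, max (x σ i) (x' σ i) ∂(expPi N ν) ≤ 2 := by
    rw [← integral_finsetSum _ fun j _ => imax j]
    have : ∫ σ : Fin N → ℝ, (2:ℝ) ∂(expPi N ν) = 2 := by simp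
    rw [← this]
    refine integral_mono_ae (integrable_finsetSum _ fun j _ => imax j) (integrable_const _) ?_
    filter_upwards [expPi_nonneg hν] with σ hσ
    calc ∑ i, max (x σ i) (x' σ i) ≤ ∑ i, (x σ i + x' σ i) := Finset.sum_le_sum fun i _ =>
          max_le (by linarith [(hx' σ hσ).1 i]) (by linarith [(hx σ hσ).1 i])
      _ = 2 := by rw [Finset.sum_add_distrib, (hx σ hσ).2, (hx' σ hσ).2]; norm_num
  have htot : D ≤ ν * s * 2 + N * ((lam * D + 3 * ε) / s) := by
    rw [hDsum]
    refine (Finset.sum_le_sum fun i _ => hcoord i).trans ?_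
    rw [Finset.sum_add_distrib, ← Finset.mul_sum]
    simp only [Finset.sum_const, Finset.card_univ, Fintype.card_fin, nsmul_eq_mul]
    rw [← hDsum]
    gcongr
  have h9 : N * ((lam * D + 3 * ε) / s) = D / 2 + (3 * ε / lam) / 2 := by
    rw [hsdef]; field_simp
  rw [h9, hsdef] at htot
  linarith

lemma l1OpNorm_bdd {N M : ℕ} (A : Matrix (Fin N) (Fin M) ℝ) :
    BddAbove {r : ℝ | ∃ u : Fin M → ℝ, (∑ j, |u j|) = 1 ∧ r = ∑ i, |A.mulVec u i|} := by
  refine ⟨∑ i, ∑ j, |A i j|, ?_⟩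
  rintro r ⟨u, hu, rfl⟩
  refine Finset.sum_le_sum fun i _ => ?_
  simp only [Matrix.mulVec, dotProduct]
  refine (Finset.abs_sum_le_sum_abs _ _).trans (Finset.sum_le_sum fun j _ => ?_)
  rw [abs_mul]
  have h1 : |u j| ≤ 1 := by
    rw [← hu]
    exact Finset.single_le_sum (f := fun j => |u j|) (fun j _ => abs_nonneg _) (Finset.mem_univ j)
  exact mul_le_of_le_one_right (abs_nonneg _) h1

lemma l1OpNorm_nonneg {N M : ℕ} (A : Matrix (Fin N) (Fin M) ℝ) : 0 ≤ l1OpNorm A := by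
  refine Real.sSup_nonneg ?_
  rintro r ⟨u, _, rfl⟩
  exact Finset.sum_nonneg fun i _ => abs_nonneg _

lemma l1OpNorm_col {N M : ℕ} (A : Matrix (Fin N) (Fin M) ℝ) (j : Fin M) :
    ∑ i, |A i j| ≤ l1OpNorm A := by
  refine le_csSup (l1OpNorm_bdd A) ⟨Pi.single j 1, ?_, ?_⟩
  · rw [Finset.sum_eq_single j] <;> simp +contextual
  · simp

lemma l1OpNorm_entry {N M : ℕ} (A : Matrix (Fin N) (Fin M) ℝ) (i : Fin N) (j : Fin M) :
    |A i j| ≤ l1OpNorm A :=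
  (Finset.single_le_sum (f := fun i => |A i j|) (fun j _ => abs_nonneg _)
    (Finset.mem_univ i)).trans (l1OpNorm_col A j)

lemma l1OpNorm_pos {N M : ℕ} (A : Matrix (Fin N) (Fin M) ℝ) (hA : A ≠ 0) : 0 < l1OpNorm A := by
  by_contra hcon
  apply hA
  ext i j
  have := l1OpNorm_entry A i j
  exact abs_eq_zero.1 (le_antisymm (this.trans (not_lt.1 hcon)) (abs_nonneg _))

lemma qr_nonneg {N M : ℕ} (η : ℝ) (V : Matrix (Fin N) (Fin M) ℝ) (z : Fin N → ℝ) (j : Fin M) :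
    0 ≤ qr η V z j := by
  unfold qr
  positivity

lemma qr_sum {N M : ℕ} (hM : 0 < M) (η : ℝ) (V : Matrix (Fin N) (Fin M) ℝ) (z : Fin N → ℝ) :
    ∑ j, qr η V z j = 1 := by
  have : Nonempty (Fin M) := ⟨⟨0, hM⟩⟩
  unfold qr
  rw [← Finset.sum_div]
  exact div_self (Finset.sum_pos (fun j _ => Real.exp_pos _) Finset.univ_nonempty).ne'

lemma qr_lip {N M : ℕ} (hM : 0 < M) {η : ℝ} (hη : 0 < η) (V : Matrix (Fin N) (Fin M) ℝ)
    (z z' : Fin N → ℝ) (j : Fin M) :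
    qr η V z j - qr η V z' j ≤ 2 * η * l1OpNorm V * (∑ i, |z i - z' i|) * qr η V z j := by
  have : Nonempty (Fin M) := ⟨⟨0, hM⟩⟩
  set d := η * l1OpNorm V * (∑ i, |z i - z' i|) with hd
  have hlog : ∀ j, |η * ∑ n, V n j * z n - η * ∑ n, V n j * z' n| ≤ d := by
    intro j
    rw [← mul_sub, abs_mul, abs_of_pos hη, hd, mul_assoc, ← Finset.sum_sub_distrib, Finset.mul_sum]
    refine mul_le_mul_of_nonneg_left ?_ hη.le
    refine (Finset.abs_sum_le_sum_abs _ _).trans (Finset.sum_le_sum fun n _ => ?_)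
    rw [← mul_sub, abs_mul]
    exact mul_le_mul_of_nonneg_right (l1OpNorm_entry V n j) (abs_nonneg _)
  set S := ∑ j, Real.exp (η * ∑ n, V n j * z n) with hS
  set S' := ∑ j, Real.exp (η * ∑ n, V n j * z' n) with hS'
  have hSp : 0 < S := Finset.sum_pos (fun j _ => Real.exp_pos _) Finset.univ_nonempty
  have hSp' : 0 < S' := Finset.sum_pos (fun j _ => Real.exp_pos _) Finset.univ_nonempty
  have h1 : S' ≤ Real.exp d * S := by
    rw [hS, hS', Finset.mul_sum]
    refine Finset.sum_le_sum fun j _ => ?_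
    rw [← Real.exp_add]
    exact Real.exp_le_exp.2 (by linarith [(abs_le.1 (hlog j)).1])
  have h2 : Real.exp (-d) * Real.exp (η * ∑ n, V n j * z n) ≤
      Real.exp (η * ∑ n, V n j * z' n) := by
    rw [← Real.exp_add]
    exact Real.exp_le_exp.2 (by linarith [(abs_le.1 (hlog j)).2])
  have h3 : Real.exp (-(2 * d)) * qr η V z j ≤ qr η V z' j := by
    unfold qr
    rw [← hS, ← hS', ← mul_div_assoc, div_le_div_iff₀ hSp hSp']
    have e : Real.exp (-(2 * d)) * Real.exp d = Real.exp (-d) := by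
      rw [← Real.exp_add]; congr 1; ring
    calc _ ≤ Real.exp (-(2 * d)) * Real.exp (η * ∑ n, V n j * z n) * (Real.exp d * S) := by
          gcongr
      _ = (Real.exp (-(2 * d)) * Real.exp d) * Real.exp (η * ∑ n, V n j * z n) * S := by ring
      _ ≤ _ := by
        rw [e]
        gcongr
  have h4 := Real.add_one_le_exp (-(2 * d))
  have h5 := mul_le_mul_of_nonneg_right h4 (qr_nonneg η V z j)
  have h6 : 2 * η * l1OpNorm V * (∑ i, |z i - z' i|) = 2 * d := by rw [hd]; ring
  rw [h6]
  linarith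

lemma payoff_row {N M : ℕ} (U : Matrix (Fin N) (Fin M) ℝ)
    {y : Fin M → ℝ} (hy : ∀ j, 0 ≤ y j) (hy1 : ∑ j, y j = 1) (i : Fin N) :
    ∑ j, U i j * y j ≤ l1OpNorm U := by
  calc ∑ j, U i j * y j ≤ ∑ j, l1OpNorm U * y j := Finset.sum_le_sum fun j _ =>
        mul_le_mul_of_nonneg_right ((le_abs_self _).trans (l1OpNorm_entry U i j)) (hy j)
    _ = l1OpNorm U := by rw [← Finset.mul_sum, hy1, mul_one]

lemma payoff_le {N M : ℕ} (U : Matrix (Fin N) (Fin M) ℝ)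
    {y : Fin M → ℝ} (hy : ∀ j, 0 ≤ y j) (hy1 : ∑ j, y j = 1)
    {x : Fin N → ℝ} (hx : x ∈ stdSimplex ℝ (Fin N)) :
    ∑ i, x i * ∑ j, U i j * y j ≤ l1OpNorm U := by
  calc ∑ i, x i * ∑ j, U i j * y j ≤ ∑ i, x i * l1OpNorm U := Finset.sum_le_sum fun i _ =>
        mul_le_mul_of_nonneg_left (payoff_row U hy hy1 i) (hx.1 i)
    _ = l1OpNorm U := by rw [← Finset.sum_mul, hx.2, one_mul]

lemma payoff_nonneg {N M : ℕ} (U : Matrix (Fin N) (Fin M) ℝ) (hU : ∀ i j, 0 ≤ U i j)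
    {y : Fin M → ℝ} (hy : ∀ j, 0 ≤ y j)
    {x : Fin N → ℝ} (hx : x ∈ stdSimplex ℝ (Fin N)) :
    0 ≤ ∑ i, x i * ∑ j, U i j * y j :=
  Finset.sum_nonneg fun i _ => mul_nonneg (hx.1 i)
    (Finset.sum_nonneg fun j _ => mul_nonneg (hU i j) (hy j))

lemma payoff_lip_x {N M : ℕ} (U : Matrix (Fin N) (Fin M) ℝ) (hU : ∀ i j, 0 ≤ U i j)
    {y : Fin M → ℝ} (hy : ∀ j, 0 ≤ y j) (hy1 : ∑ j, y j = 1) (x x' : Fin N → ℝ) :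
    ∑ i, x i * ∑ j, U i j * y j - ∑ i, x' i * ∑ j, U i j * y j ≤
      l1OpNorm U * ∑ i, |x i - x' i| := by
  rw [← Finset.sum_sub_distrib, Finset.mul_sum]
  refine Finset.sum_le_sum fun i _ => ?_
  rw [← sub_mul, mul_comm]
  have h0 : 0 ≤ ∑ j, U i j * y j := Finset.sum_nonneg fun j _ => mul_nonneg (hU i j) (hy j)
  have h1 := payoff_row U hy hy1 i
  exact (mul_le_mul_of_nonneg_left (le_abs_self _) h0).trans
    (mul_le_mul_of_nonneg_right h1 (abs_nonneg _))

lemma payoff_lip_z {N M : ℕ} (U : Matrix (Fin N) (Fin M) ℝ) (hU : ∀ i j, 0 ≤ U i j)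
    (hM : 0 < M) {η : ℝ} (hη : 0 < η) (V : Matrix (Fin N) (Fin M) ℝ)
    (z z' : Fin N → ℝ) {x : Fin N → ℝ} (hx : x ∈ stdSimplex ℝ (Fin N)) :
    ∑ i, x i * ∑ j, U i j * qr η V z j - ∑ i, x i * ∑ j, U i j * qr η V z' j ≤
      l1OpNorm U * (2 * η * l1OpNorm V) * ∑ i, |z i - z' i| := by
  set d := 2 * η * l1OpNorm V * (∑ i, |z i - z' i|) with hd
  have hd0 : 0 ≤ d := mul_nonneg (mul_nonneg (by positivity) (l1OpNorm_nonneg V))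
    (Finset.sum_nonneg fun i _ => abs_nonneg _)
  have h1 : ∑ i, x i * ∑ j, U i j * qr η V z j - ∑ i, x i * ∑ j, U i j * qr η V z' j ≤
      d * ∑ i, x i * ∑ j, U i j * qr η V z j := by
    rw [← Finset.sum_sub_distrib, Finset.mul_sum]
    refine Finset.sum_le_sum fun i _ => ?_
    rw [← mul_sub, ← Finset.sum_sub_distrib, mul_left_comm]
    refine mul_le_mul_of_nonneg_left ?_ (hx.1 i)
    rw [Finset.mul_sum]
    refine Finset.sum_le_sum fun j _ => ?_
    rw [← mul_sub, mul_left_comm]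
    exact mul_le_mul_of_nonneg_left (qr_lip hM hη V z z' j) (hU i j)
  have h2 := payoff_le U (qr_nonneg η V z) (qr_sum hM η V z) hx
  calc _ ≤ _ := h1
    _ ≤ d * l1OpNorm U := mul_le_mul_of_nonneg_left h2 hd0
    _ = _ := by rw [hd]; ring

lemma reput_dist {N : ℕ} (a : ℕ → ℝ) (ha : ∀ s, 0 ≤ a s) (ha0 : 0 < a 0)
    (x : ℕ → Fin N → ℝ) (t : ℕ) :
    ∑ i, |x t i - reput a x t i| ≤
      (memB a (t + 1))⁻¹ * ∑ τ ∈ Finset.range (t + 1), a (t - τ) * ∑ i, |x τ i - x t i| := by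
  have hb : 0 < memB a (t + 1) := by
    unfold memB
    exact Finset.sum_pos' (fun s _ => ha s) ⟨0, by simp, ha0⟩
  have hbs : ∑ τ ∈ Finset.range (t + 1), a (t - τ) = memB a (t + 1) := by
    unfold memB
    rw [← Finset.sum_range_reflect a (t + 1)]
    simp
  have hco : ∀ i, |x t i - reput a x t i| ≤
      (memB a (t + 1))⁻¹ * ∑ τ ∈ Finset.range (t + 1), a (t - τ) * |x τ i - x t i| := by
    intro i
    have e : reput a x t i - x t i =
        (memB a (t + 1))⁻¹ * ∑ τ ∈ Finset.range (t + 1), a (t - τ) * (x τ i - x t i) := by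
      simp only [reput, Pi.smul_apply, Finset.sum_apply, smul_eq_mul, mul_sub,
        Finset.sum_sub_distrib, ← Finset.sum_mul, hbs]
      field_simp
    rw [abs_sub_comm, e, abs_mul, abs_of_pos (inv_pos.2 hb)]
    refine mul_le_mul_of_nonneg_left ?_ (inv_pos.2 hb).le
    refine (Finset.abs_sum_le_sum_abs _ _).trans (Finset.sum_le_sum fun τ _ => ?_)
    rw [abs_mul, abs_of_nonneg (ha _)]
  refine (Finset.sum_le_sum fun i _ => hco i).trans (le_of_eq ?_)
  rw [← Finset.mul_sum, Finset.sum_comm]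
  congr 1
  exact Finset.sum_congr rfl fun τ _ => (Finset.mul_sum _ _ _).symm

lemma memTheta_avg (a : ℕ → ℝ) (ha : ∀ s, 0 ≤ a s) (ha0 : 0 < a 0) (t : ℕ) (A B : ℝ) :
    (memB a (t + 1))⁻¹ * ∑ τ ∈ Finset.range (t + 1), a (t - τ) * (A * ((t - τ : ℕ) : ℝ) + B)
      = A * memTheta a (t + 1) + B := by
  have hb : 0 < memB a (t + 1) := by
    unfold memB
    exact Finset.sum_pos' (fun s _ => ha s) ⟨0, by simp, ha0⟩
  have e : ∑ τ ∈ Finset.range (t + 1), a (t - τ) * (A * ((t - τ : ℕ) : ℝ) + B) =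
      ∑ s ∈ Finset.range (t + 1), a s * (A * (s : ℝ) + B) := by
    rw [← Finset.sum_range_reflect (fun s => a s * (A * (s : ℝ) + B))]
    simp
  have e2 : ∑ s ∈ Finset.range (t + 1), a s * (A * (s : ℝ) + B) =
      A * (∑ s ∈ Finset.range (t + 1), a s * (s : ℝ)) + B * memB a (t + 1) := by
    unfold memB
    rw [Finset.mul_sum, Finset.mul_sum, ← Finset.sum_add_distrib]
    exact Finset.sum_congr rfl fun s _ => by ring
  rw [e, e2]
  unfold memTheta
  field_simp

lemma memTheta_nonneg (a : ℕ → ℝ) (ha : ∀ s, 0 ≤ a s) (t : ℕ) : 0 ≤ memTheta a t :=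
  mul_nonneg (inv_nonneg.2 (Finset.sum_nonneg fun s _ => ha s))
    (Finset.sum_nonneg fun s _ => mul_nonneg (ha s) (Nat.cast_nonneg s))

/-- The pointwise (be-the-leader) regret bound. -/
lemma pointwise_regret {N n : ℕ} {ε c u : ℝ} (hc : 0 ≤ c)
    (p : ℕ → (Fin N → ℝ) → (Fin N → ℝ) → ℝ)
    (hp0 : ∀ t < n + 1, ∀ z, ∀ y ∈ stdSimplex ℝ (Fin N), 0 ≤ p t z y ∧ p t z y ≤ u)
    (hLip : ∀ t < n + 1, ∀ y ∈ stdSimplex ℝ (Fin N), ∀ y' ∈ stdSimplex ℝ (Fin N),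
      p t y y - p t y' y' ≤ c * ∑ i, |y i - y' i|)
    (hLipz : ∀ t < n + 1, ∀ z z', ∀ y ∈ stdSimplex ℝ (Fin N),
      p t z y - p t z' y ≤ c * ∑ i, |z i - z' i|)
    (a : ℕ → ℝ) (ha : ∀ s, 0 ≤ a s) (ha0 : 0 < a 0)
    (σ : Fin N → ℝ) (hσ : ∀ i, 0 ≤ σ i) (x : ℕ → Fin N → ℝ)
    (hx : ∀ t < n + 1, x t ∈ stdSimplex ℝ (Fin N))
    (ho : ∀ t < n + 1, ∀ y ∈ stdSimplex ℝ (Fin N),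
      ∑ τ ∈ Finset.range t, p τ y y + ∑ i, σ i * y i - ε ≤
        ∑ τ ∈ Finset.range t, p τ (x t) (x t) + ∑ i, σ i * x t i)
    (y : Fin N → ℝ) (hy : y ∈ stdSimplex ℝ (Fin N)) :
    ∑ τ ∈ Finset.range (n + 1), p τ y y - ∑ t ∈ Finset.range (n + 1), p t (reput a x t) (x t) ≤
      ∑ i, σ i + ε * (n + 1) + u + c * ∑ t ∈ Finset.range n, ∑ i, |x t i - x (t + 1) i|
      + c * ∑ t ∈ Finset.range (n + 1), (memB a (t + 1))⁻¹ *
          ∑ τ ∈ Finset.range (t + 1), a (t - τ) * ∑ i, |x τ i - x t i| := by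
  have btl : ∀ m, m < n + 1 → ∑ τ ∈ Finset.range m, p τ (x m) (x m) + ∑ i, σ i * x m i ≤
      ∑ t ∈ Finset.range m, p t (x (t + 1)) (x (t + 1)) + ∑ i, σ i + m * ε := by
    intro m
    induction m with
    | zero =>
      intro hm
      have h : ∑ i, σ i * x 0 i ≤ ∑ i, σ i := Finset.sum_le_sum fun i _ =>
        mul_le_of_le_one_right (hσ i) (simplex_le_one (hx 0 hm) i)
      simpa using h
    | succ m ih =>
      intro hm
      have h1 := ih (by omega)
      have h2 := ho m (by omega) (x (m + 1)) (hx _ hm)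
      rw [Finset.sum_range_succ, Finset.sum_range_succ (fun t => p t (x (t + 1)) (x (t + 1)))]
      push_cast
      linarith
  have h1 := btl n (by omega)
  have h2 := ho n (by omega) y hy
  have h3 : 0 ≤ ∑ i, σ i * y i := Finset.sum_nonneg fun i _ => mul_nonneg (hσ i) (hy.1 i)
  have h4 := (hp0 n (by omega) y y hy).2
  have h5 : ∑ t ∈ Finset.range n, p t (x (t + 1)) (x (t + 1)) ≤
      ∑ t ∈ Finset.range n, p t (x t) (x t) +
        c * ∑ t ∈ Finset.range n, ∑ i, |x t i - x (t + 1) i| := by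
    rw [Finset.mul_sum, ← Finset.sum_add_distrib]
    refine Finset.sum_le_sum fun t ht => ?_
    have ht' := Finset.mem_range.1 ht
    have := hLip t (by omega) _ (hx (t + 1) (by omega)) _ (hx t (by omega))
    have h6 : ∑ i, |x (t + 1) i - x t i| = ∑ i, |x t i - x (t + 1) i| :=
      Finset.sum_congr rfl fun j _ => abs_sub_comm _ _
    rw [h6] at this
    linarith
  have h6 : ∑ t ∈ Finset.range (n + 1), p t (x t) (x t) -
      ∑ t ∈ Finset.range (n + 1), p t (reput a x t) (x t) ≤
      c * ∑ t ∈ Finset.range (n + 1), (memB a (t + 1))⁻¹ *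
          ∑ τ ∈ Finset.range (t + 1), a (t - τ) * ∑ i, |x τ i - x t i| := by
    rw [← Finset.sum_sub_distrib, Finset.mul_sum]
    refine Finset.sum_le_sum fun t ht => ?_
    have ht' := Finset.mem_range.1 ht
    exact (hLipz t ht' _ _ _ (hx t ht')).trans
      (mul_le_mul_of_nonneg_left (reput_dist a ha ha0 x t) hc)
  have h7 := (hp0 n (by omega) (x n) (x n) (hx n (by omega))).1
  have h8 : ∑ t ∈ Finset.range (n + 1), p t (x t) (x t) =
    ∑ t ∈ Finset.range n, p t (x t) (x t) + p n (x n) (x n) := Finset.sum_range_succ _ _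
  have h9 : ∑ τ ∈ Finset.range (n + 1), p τ y y =
    ∑ τ ∈ Finset.range n, p τ y y + p n y y := Finset.sum_range_succ _ _
  rw [h9]
  linarith

/-- Expected distance between two iterates. -/
lemma iterate_dist {N H : ℕ} (hN : 0 < N) {ν ε c : ℝ} (hν : 0 < ν) (hε : 0 ≤ ε) (hc : 0 < c)
    (p : ℕ → (Fin N → ℝ) → (Fin N → ℝ) → ℝ)
    (hLip : ∀ t < H, ∀ y ∈ stdSimplex ℝ (Fin N), ∀ y' ∈ stdSimplex ℝ (Fin N),
      p t y y - p t y' y' ≤ c * ∑ i, |y i - y' i|)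
    (x : ℕ → (Fin N → ℝ) → Fin N → ℝ) (hxm : ∀ t, Measurable (x t))
    (hx : ∀ t < H, ∀ σ : Fin N → ℝ, (∀ i, 0 ≤ σ i) → x t σ ∈ stdSimplex ℝ (Fin N))
    (ho : ∀ σ : Fin N → ℝ, (∀ i, 0 ≤ σ i) → ∀ t < H, ∀ y ∈ stdSimplex ℝ (Fin N),
      ∑ τ ∈ Finset.range t, p τ y y + ∑ i, σ i * y i - ε ≤
        ∑ τ ∈ Finset.range t, p τ (x t σ) (x t σ) + ∑ i, σ i * x t σ i)
    (τ m : ℕ) (hm : τ + m < H) :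
    ∫ σ, ∑ i, |x τ σ i - x (τ + m) σ i| ∂(expPi N ν) ≤ 8 * N * ν * c * m + 3 * ε / c := by
  obtain rfl | hm0 := Nat.eq_zero_or_pos m
  · simp only [add_zero, sub_self, abs_zero, Finset.sum_const_zero, integral_zero]
    positivity
  have hmr : (1:ℝ) ≤ m := by exact_mod_cast hm0
  have key := ftpl_stability hN hν hε (lam := c * m) (by positivity)
    (fun y => ∑ s ∈ Finset.range τ, p s y y) (fun y => ∑ s ∈ Finset.range m, p (τ + s) y y)
    (x τ) (x (τ + m)) (hxm _) (hxm _) (hx _ (by omega)) (hx _ hm) ?_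
    (fun σ hσ => ho σ hσ τ (by omega)) ?_
  · refine key.trans ?_
    have : 3 * ε / (c * m) ≤ 3 * ε / c := by
      gcongr
      exact le_mul_of_one_le_right hc.le hmr
    linarith
  · intro y hy y' hy'
    rw [← Finset.sum_sub_distrib]
    have : c * m * ∑ j, |y j - y' j| = ∑ s ∈ Finset.range m, c * ∑ j, |y j - y' j| := by
      simp; ring
    rw [this]
    refine Finset.sum_le_sum fun s hs => ?_
    have := Finset.mem_range.1 hs
    exact hLip _ (by omega) y hy y' hy'
  · intro σ hσ y hy
    have := ho σ hσ (τ + m) hm y hy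
    rw [Finset.sum_range_add, Finset.sum_range_add] at this
    exact this

lemma final_arith {N H T c u ε ν R : ℝ} (hN : 1 ≤ N) (hH : 1 ≤ H) (hT : H ≤ T) (hc : 0 < c)
    (hu : u ≤ c) (hR : R = Real.sqrt (50 * N * T)) (hν : ν = (c * R)⁻¹) :
    N / ν + ε * H + u + c * (H * (8 * N * ν * c) + H * (3 * ε / c))
      + c * (8 * N * ν * c * (T - H) + H * (3 * ε / c))
      ≤ 10 * N * c * Real.sqrt (2 * N * T) + 7 * ε * H := by
  have hNT : 1 ≤ N * T := by nlinarith
  have hR2 : R * R = 50 * N * T := by rw [hR]; exact Real.mul_self_sqrt (by nlinarith)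
  have hR7 : 7 ≤ R := by
    rw [hR]; exact Real.le_sqrt_of_sq_le (by nlinarith)
  have h5 : R = 5 * Real.sqrt (2 * N * T) := by
    rw [hR, show 50 * N * T = 5 ^ 2 * (2 * N * T) by ring, Real.sqrt_mul (by norm_num),
      Real.sqrt_sq (by norm_num)]
  have hRp : 0 < R := by linarith
  have e1 : N / ν = N * c * R := by rw [hν]; field_simp
  have e2 : c * (8 * N * ν * c) * T = 8 / 50 * c * R := by
    rw [hν]
    field_simp
    nlinarith
  have e3 : c * (3 * ε / c) = 3 * ε := by field_simp
  have e4 : 10 * N * c * Real.sqrt (2 * N * T) = 2 * N * c * R := by rw [h5]; ring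
  rw [e1, e4]
  have e5 : N * c * R + ε * H + u + c * (H * (8 * N * ν * c) + H * (3 * ε / c))
      + c * (8 * N * ν * c * (T - H) + H * (3 * ε / c)) =
      N * c * R + ε * H + u + c * (8 * N * ν * c) * T + 2 * H * (c * (3 * ε / c)) := by ring
  rw [e5, e2, e3]
  have e6 : c * R ≤ N * (c * R) := le_mul_of_one_le_left (by positivity) hN
  have e7 : 7 * c ≤ c * R := by nlinarith
  nlinarith

lemma main_abstract {N n : ℕ} (hN : 0 < N) {ν ε c u : ℝ} (hε : 0 ≤ ε) (hc : 0 < c)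
    (huc : u ≤ c)
    (p : ℕ → (Fin N → ℝ) → (Fin N → ℝ) → ℝ)
    (hp0 : ∀ t < n + 1, ∀ z, ∀ y ∈ stdSimplex ℝ (Fin N), 0 ≤ p t z y ∧ p t z y ≤ u)
    (hLip : ∀ t < n + 1, ∀ y ∈ stdSimplex ℝ (Fin N), ∀ y' ∈ stdSimplex ℝ (Fin N),
      p t y y - p t y' y' ≤ c * ∑ i, |y i - y' i|)
    (hLipz : ∀ t < n + 1, ∀ z z', ∀ y ∈ stdSimplex ℝ (Fin N),
      p t z y - p t z' y ≤ c * ∑ i, |z i - z' i|)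
    (a : ℕ → ℝ) (ha : ∀ s, 0 ≤ a s) (ha0 : 0 < a 0)
    (hν : ν = (c * Real.sqrt (50 * N * (memThetaSum a (n + 1) + (n + 1 : ℕ))))⁻¹)
    (x : ℕ → (Fin N → ℝ) → Fin N → ℝ) (hxm : ∀ t, Measurable (x t))
    (hx : ∀ t < n + 1, ∀ σ : Fin N → ℝ, (∀ i, 0 ≤ σ i) → x t σ ∈ stdSimplex ℝ (Fin N))
    (ho : ∀ σ : Fin N → ℝ, (∀ i, 0 ≤ σ i) → ∀ t < n + 1, ∀ y ∈ stdSimplex ℝ (Fin N),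
      ∑ τ ∈ Finset.range t, p τ y y + ∑ i, σ i * y i - ε ≤
        ∑ τ ∈ Finset.range t, p τ (x t σ) (x t σ) + ∑ i, σ i * x t σ i) :
    (∫ σ, (sSup ((fun y => ∑ τ ∈ Finset.range (n + 1), p τ y y) '' stdSimplex ℝ (Fin N))
        - ∑ t ∈ Finset.range (n + 1), p t (reput a (fun τ => x τ σ) t) (x t σ)) ∂(expPi N ν)) ≤
      10 * N * c * Real.sqrt (2 * N * ((n + 1 : ℕ) + memThetaSum a (n + 1)))
        + ε * (13 * (n + 1 : ℕ) + 1) := by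
  set T : ℝ := memThetaSum a (n + 1) + (n + 1 : ℕ) with hTdef
  have hNr : (1:ℝ) ≤ N := by exact_mod_cast hN
  have hΘ : 0 ≤ memThetaSum a (n + 1) := Finset.sum_nonneg fun t _ => memTheta_nonneg a ha _
  have hH1 : (1:ℝ) ≤ ((n + 1 : ℕ) : ℝ) := by exact_mod_cast Nat.le_add_left 1 n
  have hTH : ((n + 1 : ℕ) : ℝ) ≤ T := by rw [hTdef]; linarith
  have hνp : 0 < ν := by
    rw [hν]
    refine inv_pos.2 (mul_pos hc (Real.sqrt_pos.2 ?_))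
    nlinarith
  have hprob := expPi_prob (N := N) hνp
  set D : ℕ → ℕ → (Fin N → ℝ) → ℝ := fun τ t σ => ∑ i, |x τ σ i - x t σ i| with hDdef
  have hDint : ∀ τ < n + 1, ∀ t < n + 1, Integrable (D τ t) (expPi N ν) := by
    intro τ hτ t ht
    refine integrable_finsetSum _ fun i _ => integrable_of_bdd hνp
      (_root_.continuous_abs.measurable.comp (((measurable_pi_apply i).comp (hxm τ)).sub
        ((measurable_pi_apply i).comp (hxm t)))) 1 fun σ hσ => ?_
    change |(|x τ σ i - x t σ i|)| ≤ 1
    rw [abs_abs, abs_le]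
    have a1 := simplex_le_one (hx τ hτ σ hσ) i
    have a2 := simplex_le_one (hx t ht σ hσ) i
    have a3 := (hx τ hτ σ hσ).1 i
    have a4 := (hx t ht σ hσ).1 i
    constructor <;> linarith
  have hDbd : ∀ t < n + 1, ∀ τ ≤ t, ∫ σ, D τ t σ ∂(expPi N ν) ≤
      8 * N * ν * c * ((t - τ : ℕ) : ℝ) + 3 * ε / c := by
    intro t ht τ hτ
    have := iterate_dist hN hνp hε hc p hLip x hxm hx ho τ (t - τ) (by omega)
    rwa [Nat.add_sub_cancel' hτ] at this
  -- integrable upper bound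
  have i1 : Integrable (fun σ : Fin N → ℝ => ∑ i, σ i + ε * (n + 1) + u) (expPi N ν) :=
    ((expPi_sum_integrable hνp).add (integrable_const _)).add (integrable_const _)
  have i2 : Integrable (fun σ => c * ∑ t ∈ Finset.range n, D t (t + 1) σ) (expPi N ν) := by
    refine (integrable_finsetSum _ fun t ht => ?_).const_mul c
    have := Finset.mem_range.1 ht
    exact hDint _ (by omega) _ (by omega)
  have i3' : ∀ t < n + 1, Integrable (fun σ => (memB a (t + 1))⁻¹ *
      ∑ τ ∈ Finset.range (t + 1), a (t - τ) * D τ t σ) (expPi N ν) := by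
    intro t ht
    refine (integrable_finsetSum _ fun τ hτ => ?_).const_mul _
    have := Finset.mem_range.1 hτ
    exact (hDint _ (by omega) _ (by omega)).const_mul _
  have i3 : Integrable (fun σ => c * ∑ t ∈ Finset.range (n + 1), (memB a (t + 1))⁻¹ *
      ∑ τ ∈ Finset.range (t + 1), a (t - τ) * D τ t σ) (expPi N ν) :=
    (integrable_finsetSum _ fun t ht => i3' t (Finset.mem_range.1 ht)).const_mul c
  have v1 : ∫ σ : Fin N → ℝ, (∑ i, σ i + ε * (n + 1) + u) ∂(expPi N ν) =
      N / ν + ε * (n + 1) + u := by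
    have i0 := expPi_sum_integrable (N := N) hνp
    have i01 : Integrable (fun σ : Fin N → ℝ => ∑ i, σ i + ε * (n + 1)) (expPi N ν) :=
      i0.add (integrable_const _)
    rw [integral_add i01 (integrable_const _), integral_add i0 (integrable_const _),
      expPi_sum hνp]
    simp
  have h8 : 0 ≤ 8 * N * ν * c := by positivity
  have h3ε : 0 ≤ 3 * ε / c := by positivity
  have v2 : ∫ σ, c * ∑ t ∈ Finset.range n, D t (t + 1) σ ∂(expPi N ν) ≤
      c * (((n + 1 : ℕ) : ℝ) * (8 * N * ν * c) + ((n + 1 : ℕ) : ℝ) * (3 * ε / c)) := by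
    rw [integral_const_mul, integral_finsetSum]
    · refine mul_le_mul_of_nonneg_left ?_ hc.le
      calc ∑ t ∈ Finset.range n, ∫ σ, D t (t + 1) σ ∂(expPi N ν)
          ≤ ∑ t ∈ Finset.range n, (8 * N * ν * c + 3 * ε / c) := by
            refine Finset.sum_le_sum fun t ht => ?_
            have := Finset.mem_range.1 ht
            have h := hDbd (t + 1) (by omega) t (by omega)
            simpa using h
        _ = n * (8 * N * ν * c + 3 * ε / c) := by simp [mul_add]
        _ ≤ _ := by push_cast; nlinarith
    · intro t ht
      have := Finset.mem_range.1 ht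
      exact hDint _ (by omega) _ (by omega)
  have v3 : ∫ σ, c * ∑ t ∈ Finset.range (n + 1), (memB a (t + 1))⁻¹ *
      ∑ τ ∈ Finset.range (t + 1), a (t - τ) * D τ t σ ∂(expPi N ν) ≤
      c * (8 * N * ν * c * (T - (n + 1 : ℕ)) + ((n + 1 : ℕ) : ℝ) * (3 * ε / c)) := by
    rw [integral_const_mul, integral_finsetSum _ fun t ht => i3' t (Finset.mem_range.1 ht)]
    refine mul_le_mul_of_nonneg_left ?_ hc.le
    calc _ ≤ ∑ t ∈ Finset.range (n + 1), (8 * N * ν * c * memTheta a (t + 1) + 3 * ε / c) := by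
          refine Finset.sum_le_sum fun t ht => ?_
          have ht' := Finset.mem_range.1 ht
          rw [← memTheta_avg a ha ha0, integral_const_mul, integral_finsetSum]
          · refine mul_le_mul_of_nonneg_left (Finset.sum_le_sum fun τ hτ => ?_)
              (inv_nonneg.2 (Finset.sum_nonneg fun s _ => ha s))
            rw [integral_const_mul]
            have := Finset.mem_range.1 hτ
            exact mul_le_mul_of_nonneg_left (hDbd t ht' τ (by omega)) (ha _)
          · intro τ hτ
            have := Finset.mem_range.1 hτ
            exact (hDint _ (by omega) _ (by omega)).const_mul _
      _ = _ := by
          rw [Finset.sum_add_distrib, ← Finset.mul_sum, hTdef]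
          simp [memThetaSum]
  have hfin := final_arith (ε := ε) hNr hH1 hTH hc huc rfl hν
  have hsq : (((n + 1 : ℕ) : ℝ) + memThetaSum a (n + 1)) = T := by rw [hTdef]; ring
  rw [hsq]
  have hεH : 0 ≤ ε * ((n + 1 : ℕ) : ℝ) := by positivity
  by_cases hI : Integrable (fun σ =>
      (sSup ((fun y => ∑ τ ∈ Finset.range (n + 1), p τ y y) '' stdSimplex ℝ (Fin N))
        - ∑ t ∈ Finset.range (n + 1), p t (reput a (fun τ => x τ σ) t) (x t σ))) (expPi N ν)
  swap
  · rw [integral_undef hI]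
    positivity
  have hmono := integral_mono_ae hI ((i1.add i2).add i3) (by
    filter_upwards [expPi_nonneg hνp] with σ hσ
    simp only [Pi.add_apply]
    rw [sub_le_iff_le_add]
    refine csSup_le ?_ ?_
    · exact ⟨_, ⟨x 0 σ, hx 0 (by omega) σ hσ, rfl⟩⟩
    · rintro _ ⟨y, hy, rfl⟩
      simp only
      rw [← sub_le_iff_le_add]
      exact pointwise_regret hc.le p hp0 hLip hLipz a ha ha0 σ hσ (fun τ => x τ σ)
        (fun t ht => hx t ht σ hσ) (ho σ hσ) y hy)
  refine hmono.trans ?_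
  rw [integral_add' (i1.add i2) i3, integral_add' i1 i2, v1]
  have hcast : ((n + 1 : ℕ) : ℝ) = (n:ℝ) + 1 := by push_cast; ring
  have hcε : ε * ((n + 1 : ℕ) : ℝ) = ε * ((n:ℝ) + 1) := by rw [hcast]
  nlinarith
/-- **Theorem 3: regret bound of FTPL against quantal-responding followers with memory,
with tuned perturbation rate `ν = 1/(‖U‖₁(1+L)√(50N(Θ_H+H)))` (and `U ≠ 0`).**  Leader payoff matrix `U ≥ 0`; follower payoff matrices
`V^1, …, V^K` with `L = 2η max_k ‖V^k‖₁`; nonnegative memory weights `a` with `a 0 > 0`;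
follower types `g^1, …, g^H ∈ {e_1,…,e_K}` with partial sums `G^t`; `σ` has i.i.d.
exponential(ν) coordinates; the decision `x^t(σ) ∈ Δ_N` is an `ε`-approximate maximizer of
`x ↦ ⟨𝒴_QR(x)ᵀUᵀx, G^{t−1}⟩ + ⟨σ, x⟩` over `Δ_N` for every `σ ≥ 0` (0-indexed: round
`t < H` uses `G t = ∑_{τ<t} g τ`).  Then
`E[max_{x∈Δ_N} ⟨𝒴_QR(x)ᵀUᵀx, G^H⟩ − ∑_t ⟨𝒴_QR(z^t)ᵀUᵀx^t, g^t⟩]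
  ≤ 10N‖U‖₁(1+L)√(2N(H+Θ_H)) + ε(13H+1)`. -/
theorem stmt10 {N M K : ℕ} (hN : 0 < N) (hM : 0 < M) (hK : 0 < K)
    (H : ℕ) (hH : 0 < H)
    (ε ν η : ℝ) (hε : 0 ≤ ε) (hη : 0 < η)
    (U : Matrix (Fin N) (Fin M) ℝ) (hU : ∀ i j, 0 ≤ U i j) (hU0 : U ≠ 0)
    (V : Fin K → Matrix (Fin N) (Fin M) ℝ) (L : ℝ)
    (hL : L = 2 * η * Finset.univ.sup' (Finset.univ_nonempty_iff.mpr ⟨⟨0, hK⟩⟩)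
      (fun k => l1OpNorm (V k)))
    (a : ℕ → ℝ) (ha : ∀ s, 0 ≤ a s) (ha0 : 0 < a 0)
    (hν : ν = (l1OpNorm U * (1 + L) * Real.sqrt (50 * N * (memThetaSum a H + H)))⁻¹)
    (g : ℕ → Fin K → ℝ) (hg : ∀ t < H, ∃ k, g t = Pi.single k 1)
    (x : ℕ → (Fin N → ℝ) → (Fin N → ℝ)) (hxmeas : ∀ t, Measurable (x t))
    (hxsimplex : ∀ t < H, ∀ σ : Fin N → ℝ, (∀ i, 0 ≤ σ i) → x t σ ∈ stdSimplex ℝ (Fin N))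
    (hOracle : ∀ σ : Fin N → ℝ, (∀ i, 0 ≤ σ i) → ∀ t < H,
      sSup ((fun y => qrPayoff η U V y y (∑ τ ∈ Finset.range t, g τ) + ∑ i, σ i * y i) ''
          stdSimplex ℝ (Fin N)) - ε ≤
        qrPayoff η U V (x t σ) (x t σ) (∑ τ ∈ Finset.range t, g τ) + ∑ i, σ i * x t σ i) :
    (∫ σ, (sSup ((fun y => qrPayoff η U V y y (∑ τ ∈ Finset.range H, g τ)) ''
          stdSimplex ℝ (Fin N))
        - ∑ t ∈ Finset.range H,
            qrPayoff η U V (reput a (fun τ => x τ σ) t) (x t σ) (g t))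
      ∂(expPi N ν)) ≤
      10 * N * l1OpNorm U * (1 + L) * Real.sqrt (2 * N * (H + memThetaSum a H))
        + ε * (13 * H + 1) := by
  obtain ⟨n, rfl⟩ : ∃ n, H = n + 1 := ⟨H - 1, by omega⟩
  set u := l1OpNorm U with hu
  have hup : 0 < u := l1OpNorm_pos U hU0
  have hVL : ∀ k, 2 * η * l1OpNorm (V k) ≤ L := by
    intro k
    rw [hL]
    exact mul_le_mul_of_nonneg_left
      (Finset.le_sup' (fun k => l1OpNorm (V k)) (Finset.mem_univ k)) (by positivity)
  have hL0 : 0 ≤ L := (mul_nonneg (by positivity) (l1OpNorm_nonneg (V ⟨0, hK⟩))).trans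
    (hVL ⟨0, hK⟩)
  have hc : 0 < u * (1 + L) := by positivity
  have huc : u ≤ u * (1 + L) := le_mul_of_one_le_right hup.le (by linarith)
  have huL : u * L ≤ u * (1 + L) := mul_le_mul_of_nonneg_left (by linarith) hup.le
  have hsingle : ∀ t < n + 1, ∃ k, ∀ z y, qrPayoff η U V z y (g t) =
      ∑ i, y i * ∑ j, U i j * qr η (V k) z j := by
    intro t ht
    obtain ⟨k, hk⟩ := hg t ht
    refine ⟨k, fun z y => ?_⟩
    unfold qrPayoff
    rw [hk, Finset.sum_eq_single k]
    · simp
    · intro b _ hb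
      simp [hb]
    · simp
  have hlin : ∀ t z y, qrPayoff η U V z y (∑ τ ∈ Finset.range t, g τ) =
      ∑ τ ∈ Finset.range t, qrPayoff η U V z y (g τ) := by
    intro t z y
    unfold qrPayoff
    rw [Finset.sum_comm]
    refine Finset.sum_congr rfl fun k _ => ?_
    rw [Finset.sum_apply, Finset.sum_mul]
  have hp0 : ∀ t < n + 1, ∀ z, ∀ y ∈ stdSimplex ℝ (Fin N),
      0 ≤ qrPayoff η U V z y (g t) ∧ qrPayoff η U V z y (g t) ≤ u := by
    intro t ht z y hy
    obtain ⟨k, hk⟩ := hsingle t ht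
    rw [hk]
    exact ⟨payoff_nonneg U hU (qr_nonneg _ _ _) hy,
      payoff_le U (qr_nonneg _ _ _) (qr_sum hM _ _ _) hy⟩
  have hLz : ∀ t < n + 1, ∀ z z', ∀ y ∈ stdSimplex ℝ (Fin N),
      qrPayoff η U V z y (g t) - qrPayoff η U V z' y (g t) ≤ u * L * ∑ i, |z i - z' i| := by
    intro t ht z z' y hy
    obtain ⟨k, hk⟩ := hsingle t ht
    rw [hk, hk]
    refine (payoff_lip_z U hU hM hη (V k) z z' hy).trans ?_
    exact mul_le_mul_of_nonneg_right (mul_le_mul_of_nonneg_left (hVL k) hup.le)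
      (Finset.sum_nonneg fun i _ => abs_nonneg _)
  have hLipz : ∀ t < n + 1, ∀ z z', ∀ y ∈ stdSimplex ℝ (Fin N),
      qrPayoff η U V z y (g t) - qrPayoff η U V z' y (g t) ≤
        u * (1 + L) * ∑ i, |z i - z' i| := fun t ht z z' y hy =>
    (hLz t ht z z' y hy).trans (mul_le_mul_of_nonneg_right huL
      (Finset.sum_nonneg fun i _ => abs_nonneg _))
  have hLip : ∀ t < n + 1, ∀ y ∈ stdSimplex ℝ (Fin N), ∀ y' ∈ stdSimplex ℝ (Fin N),
      qrPayoff η U V y y (g t) - qrPayoff η U V y' y' (g t) ≤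
        u * (1 + L) * ∑ i, |y i - y' i| := by
    intro t ht y hy y' hy'
    have h1 := hLz t ht y y' y hy
    have h2 : qrPayoff η U V y' y (g t) - qrPayoff η U V y' y' (g t) ≤ u * ∑ i, |y i - y' i| := by
      obtain ⟨k, hk⟩ := hsingle t ht
      rw [hk, hk]
      exact payoff_lip_x U hU (qr_nonneg _ _ _) (qr_sum hM _ _ _) y y'
    linarith
  have ho : ∀ σ : Fin N → ℝ, (∀ i, 0 ≤ σ i) → ∀ t < n + 1, ∀ y ∈ stdSimplex ℝ (Fin N),
      ∑ τ ∈ Finset.range t, qrPayoff η U V y y (g τ) + ∑ i, σ i * y i - ε ≤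
        ∑ τ ∈ Finset.range t, qrPayoff η U V (x t σ) (x t σ) (g τ) + ∑ i, σ i * x t σ i := by
    intro σ hσ t ht y hy
    have h1 := hOracle σ hσ t ht
    simp only [hlin] at h1
    refine le_trans (sub_le_sub_right (le_csSup ?_ (Set.mem_image_of_mem
      (fun y => ∑ τ ∈ Finset.range t, qrPayoff η U V y y (g τ) + ∑ i, σ i * y i) hy)) ε) h1
    refine ⟨∑ τ ∈ Finset.range t, u + ∑ i, σ i, ?_⟩
    rintro _ ⟨w, hw, rfl⟩
    refine add_le_add (Finset.sum_le_sum fun τ hτ => ?_) (Finset.sum_le_sum fun i _ => ?_)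
    · have := Finset.mem_range.1 hτ
      exact (hp0 τ (by omega) w w hw).2
    · exact mul_le_of_le_one_right (hσ i) (simplex_le_one hw i)
  have key := main_abstract hN hε hc huc (fun t z y => qrPayoff η U V z y (g t)) hp0 hLip hLipz
    a ha ha0 hν x hxmeas hxsimplex ho
  simp only [hlin]
  rw [show 10 * (N:ℝ) * u * (1 + L) = 10 * N * (u * (1 + L)) by ring]
  exact key
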